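/- (i) The sequent ⇒ ψ is provable in 𝔊 if and only if h(ψ) = 1 for every TMA A and every homomorphism h from formulas to A. (ii) The sequent ψ ⇒ φ is provable in 𝔊 if and only if h(ψ) ≤ h(φ) for every TMA A and every homomorphism h from formulas to A. -/

import Mathlib

/-- A tetravalent modal algebra: a bounded distributive lattice with bottom `⊥` (= 0) and
top `⊤` (= ¬0), a De Morgan negation `compl` and a modal operator `box` satisfying
`□a ⊓ ¬a = 0` and `¬□a ⊓ a = ¬a ⊓ a`. -/
class TMA (α : Type*) extends DistribLattice α, BoundedOrder α where
  compl : α → α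
  box : α → α
  compl_compl : ∀ a : α, compl (compl a) = a
  compl_sup : ∀ a b : α, compl (a ⊔ b) = compl a ⊓ compl b
  compl_bot : compl (⊥ : α) = ⊤
  box_inf_compl : ∀ a : α, box a ⊓ compl a = ⊥
  compl_box_inf : ∀ a : α, compl (box a) ⊓ a = compl a ⊓ a
/-- Formulas built from propositional variables and the constant `⊥`
by the connectives `∧`, `∨`, `¬`, `□`. -/
inductive FormulaB : Type where
  | var : ℕ → FormulaB
  | bot : FormulaB
  | and : FormulaB → FormulaB → FormulaB
  | or : FormulaB → FormulaB → FormulaB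
  | neg : FormulaB → FormulaB
  | box : FormulaB → FormulaB
deriving DecidableEq
/-- The Font–Rius sequent calculus 𝔊.  `Gder c Δ α` means the sequent `Δ ⇒ α` has a
derivation; when `c = false` the cut rule is not allowed (cut-free derivability),
`Gder true` is plain derivability. -/
inductive Gder : Bool → Finset FormulaB → FormulaB → Prop where
  | ax (c : Bool) (α : FormulaB) : Gder c {α} α
  | modal (c : Bool) (α : FormulaB) : Gder c ∅ (α.or α.box.neg)
  | weak {c Δ α} (β : FormulaB) : Gder c Δ α → Gder c (insert β Δ) α
  | cut {Δ : Finset FormulaB} {α β : FormulaB} :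
      Gder true Δ α → Gder true (insert α Δ) β → Gder true Δ β
  | andL {c Δ γ} (α β : FormulaB) :
      Gder c (insert α (insert β Δ)) γ → Gder c (insert (α.and β) Δ) γ
  | andR {c Δ} {α β : FormulaB} : Gder c Δ α → Gder c Δ β → Gder c Δ (α.and β)
  | orL {c Δ γ} (α β : FormulaB) :
      Gder c (insert α Δ) γ → Gder c (insert β Δ) γ → Gder c (insert (α.or β) Δ) γ
  | orR1 {c Δ} {α : FormulaB} (β : FormulaB) : Gder c Δ α → Gder c Δ (α.or β)
  | orR2 {c Δ} (α : FormulaB) {β : FormulaB} : Gder c Δ β → Gder c Δ (α.or β)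
  | negRule {c} {α β : FormulaB} : Gder c {α} β → Gder c {β.neg} α.neg
  | botRule {c Δ} (α : FormulaB) : Gder c Δ FormulaB.bot → Gder c Δ α
  | nnL {c Δ β} (α : FormulaB) : Gder c (insert α Δ) β → Gder c (insert α.neg.neg Δ) β
  | nnR {c Δ} {α : FormulaB} : Gder c Δ α → Gder c Δ α.neg.neg
  | boxL {c Δ β} (α : FormulaB) :
      Gder c (insert α (insert α.neg Δ)) β → Gder c (insert α (insert α.box.neg Δ)) β
  | boxR {c Δ} {α : FormulaB} :
      Gder c Δ (α.and α.neg) → Gder c Δ (α.and α.box.neg)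
/-- A homomorphism from the algebra of formulas to a TMA `A`: it commutes with
`∧, ∨, ¬, □` and sends `⊥` to `0`. -/
structure TMAHomB (A : Type) [TMA A] where
  toFun : FormulaB → A
  map_bot : toFun FormulaB.bot = ⊥
  map_and : ∀ φ ψ : FormulaB, toFun (φ.and ψ) = toFun φ ⊓ toFun ψ
  map_or : ∀ φ ψ : FormulaB, toFun (φ.or ψ) = toFun φ ⊔ toFun ψ
  map_neg : ∀ φ : FormulaB, toFun φ.neg = TMA.compl (toFun φ)
  map_box : ∀ φ : FormulaB, toFun φ.box = TMA.box (toFun φ)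

/-- Degree-preserving consequence over all tetravalent modal algebras:
`Γ ⊨_TML α` iff for every TMA `A` and every homomorphism `h` into `A`,
the infimum of `h '' Γ` is below `h α` (the empty infimum being `⊤ = 1`). -/
def semTML (Γ : Finset FormulaB) (α : FormulaB) : Prop :=
  ∀ (A : Type) [TMA A], ∀ h : TMAHomB A, Γ.inf h.toFun ≤ h.toFun α

namespace TMA

variable {α : Type*} [TMA α]

theorem compl_le_compl {a b : α} (h : a ≤ b) : compl b ≤ compl a := by
  rw [← sup_eq_right.mpr h, compl_sup]
  exact inf_le_left

theorem sup_compl_box (a : α) : a ⊔ compl (box a) = ⊤ := by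
  have h : compl (a ⊔ compl (box a)) = ⊥ := by
    rw [compl_sup, compl_compl, inf_comm, box_inf_compl]
  rw [← compl_compl (a ⊔ compl (box a)), h, compl_bot]

theorem inf_compl_box (a : α) : a ⊓ compl (box a) = a ⊓ compl a := by
  rw [inf_comm, compl_box_inf, inf_comm]

end TMA

namespace Gder

variable {c : Bool} {Δ Δ' : Finset FormulaB} {α β γ : FormulaB}

theorem sound (h : Gder c Δ α) : semTML Δ α := by
  induction h with
  | ax _ α => intro A _ v; simp
  | modal _ α => intro A _ v; simp [v.map_or, v.map_neg, v.map_box, TMA.sup_compl_box]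
  | weak β _ ih =>
    intro A _ v
    rw [Finset.inf_insert]
    exact inf_le_right.trans (ih A v)
  | cut _ _ ih₁ ih₂ =>
    intro A _ v
    have h₂ := ih₂ A v
    rw [Finset.inf_insert] at h₂
    exact (le_inf (ih₁ A v) le_rfl).trans h₂
  | andL α β _ ih =>
    intro A _ v
    simpa only [Finset.inf_insert, v.map_and, inf_assoc] using ih A v
  | andR _ _ ih₁ ih₂ =>
    intro A _ v
    rw [v.map_and]
    exact le_inf (ih₁ A v) (ih₂ A v)
  | orL α β _ _ ih₁ ih₂ =>
    intro A _ v
    have h₁ := ih₁ A v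
    have h₂ := ih₂ A v
    rw [Finset.inf_insert] at h₁ h₂ ⊢
    rw [v.map_or, inf_sup_right]
    exact sup_le h₁ h₂
  | orR1 β _ ih =>
    intro A _ v
    rw [v.map_or]
    exact (ih A v).trans le_sup_left
  | orR2 α _ ih =>
    intro A _ v
    rw [v.map_or]
    exact (ih A v).trans le_sup_right
  | negRule _ ih =>
    intro A _ v
    have h := ih A v
    rw [Finset.inf_singleton] at h ⊢
    rw [v.map_neg, v.map_neg]
    exact TMA.compl_le_compl h
  | botRule α _ ih =>
    intro A _ v
    have h := ih A v
    rw [v.map_bot] at h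
    exact h.trans bot_le
  | nnL α _ ih =>
    intro A _ v
    simpa only [Finset.inf_insert, v.map_neg, TMA.compl_compl] using ih A v
  | nnR _ ih =>
    intro A _ v
    simpa only [v.map_neg, TMA.compl_compl] using ih A v
  | boxL α _ ih =>
    intro A _ v
    have h := ih A v
    simp only [Finset.inf_insert, v.map_neg, v.map_box, ← inf_assoc] at h ⊢
    rwa [TMA.inf_compl_box]
  | boxR _ ih =>
    intro A _ v
    have h := ih A v
    simp only [v.map_and, v.map_neg, v.map_box] at h ⊢
    rwa [TMA.inf_compl_box]

theorem mono (h : Gder c Δ α) (hs : Δ ⊆ Δ') : Gder c Δ' α := by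
  have key : ∀ Θ : Finset FormulaB, Gder c (Θ ∪ Δ) α := by
    intro Θ
    induction Θ using Finset.induction_on with
    | empty => simpa using h
    | insert β Θ _ ih =>
      rw [Finset.insert_union]
      exact weak β ih
  simpa [Finset.union_eq_left.mpr hs] using key Δ'

theorem of_mem (h : α ∈ Δ) : Gder c Δ α :=
  (ax c α).mono (Finset.singleton_subset_iff.mpr h)

theorem trans (h₁ : Gder true {α} β) (h₂ : Gder true {β} γ) : Gder true {α} γ :=
  cut h₁ (h₂.mono (by simp))

theorem and_left (α β : FormulaB) : Gder c {α.and β} α :=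
  andL (Δ := ∅) α β (of_mem (by simp))

theorem and_right (α β : FormulaB) : Gder c {α.and β} β :=
  andL (Δ := ∅) α β (of_mem (by simp))

theorem or_left (α β : FormulaB) : Gder c {α} (α.or β) := orR1 β (ax c α)

theorem or_right (α β : FormulaB) : Gder c {β} (α.or β) := orR2 α (ax c β)

theorem or_elim (h₁ : Gder c {α} γ) (h₂ : Gder c {β} γ) : Gder c {α.or β} γ :=
  orL (Δ := ∅) α β h₁ h₂

theorem or_and_or (α β γ : FormulaB) :
    Gder c {(α.or β).and (α.or γ)} (α.or (β.and γ)) := by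
  refine andL (Δ := ∅) _ _ (orL _ _ (orR1 _ (of_mem (by simp))) ?_)
  rw [Finset.insert_comm]
  exact orL _ _ (orR1 _ (of_mem (by simp)))
    (orR2 _ (andR (of_mem (by simp)) (of_mem (by simp))))

theorem neg_neg_intro (α : FormulaB) : Gder c {α} α.neg.neg := nnR (ax c α)

theorem neg_neg_elim (α : FormulaB) : Gder c {α.neg.neg} α := nnL (Δ := ∅) α (ax c α)

theorem neg_or (α β : FormulaB) : Gder c {(α.or β).neg} (α.neg.and β.neg) :=
  andR (negRule (or_left α β)) (negRule (or_right α β))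

theorem and_neg (α β : FormulaB) : Gder true {α.neg.and β.neg} (α.or β).neg :=
  (neg_neg_intro _).trans <| negRule <| or_elim
    ((neg_neg_intro α).trans (negRule (and_left _ _)))
    ((neg_neg_intro β).trans (negRule (and_right _ _)))

theorem neg_bot : Gder true ∅ FormulaB.bot.neg :=
  cut (modal true FormulaB.bot)
    ((neg_neg_intro _).trans (negRule (botRule _ (ax true FormulaB.bot))))

theorem box_and_neg (α : FormulaB) : Gder true {α.box.and α.neg} FormulaB.bot := by
  have h : Gder true {(α.or α.box.neg).neg} FormulaB.bot :=
    (negRule (weak _ (modal true α))).trans (neg_neg_elim _)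
  exact (andR (and_right _ _) ((and_left _ _).trans (neg_neg_intro _))).trans
    ((and_neg _ _).trans h)

theorem neg_box_and (α : FormulaB) : Gder c {α.box.neg.and α} (α.neg.and α) := by
  refine andL (Δ := ∅) _ _ ?_
  rw [Finset.insert_comm]
  exact boxL α (andR (of_mem (by simp)) (of_mem (by simp)))

theorem neg_and_self (α : FormulaB) : Gder true {α.neg.and α} (α.box.neg.and α) :=
  have h : Gder true {α.neg.and α} (α.and α.box.neg) :=
    boxR (andR (and_right _ _) (and_left _ _))
  andR (h.trans (and_right _ _)) (and_right _ _)

end Gder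

/-- Formulas preordered by derivability in the Font–Rius calculus. -/
instance FormulaB.instPreorder : Preorder FormulaB where
  le α β := Gder true {α} β
  le_refl α := Gder.ax true α
  le_trans _ _ _ := Gder.trans

/-- The Lindenbaum–Tarski algebra of the Font–Rius calculus. -/
abbrev Lindenbaum : Type := Antisymmetrization FormulaB (· ≤ ·)

namespace Lindenbaum

/-- The class of a formula modulo interderivability. -/
abbrev mk (α : FormulaB) : Lindenbaum := toAntisymmetrization (· ≤ ·) α

theorem mk_le_mk {α β : FormulaB} : mk α ≤ mk β ↔ Gder true {α} β := Iff.rfl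

theorem mk_eq_mk {α β : FormulaB} :
    mk α = mk β ↔ Gder true {α} β ∧ Gder true {β} α := by
  rw [le_antisymm_iff, mk_le_mk, mk_le_mk]

instance : DistribLattice Lindenbaum where
  inf := Quotient.map₂ FormulaB.and fun _ _ h₁ _ _ h₂ =>
    ⟨Gder.andR ((Gder.and_left _ _).trans h₁.1) ((Gder.and_right _ _).trans h₂.1),
      Gder.andR ((Gder.and_left _ _).trans h₁.2) ((Gder.and_right _ _).trans h₂.2)⟩
  sup := Quotient.map₂ FormulaB.or fun _ _ h₁ _ _ h₂ =>
    ⟨Gder.or_elim (Gder.orR1 _ h₁.1) (Gder.orR2 _ h₂.1),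
      Gder.or_elim (Gder.orR1 _ h₁.2) (Gder.orR2 _ h₂.2)⟩
  inf_le_left := by rintro ⟨α⟩ ⟨β⟩; exact Gder.and_left α β
  inf_le_right := by rintro ⟨α⟩ ⟨β⟩; exact Gder.and_right α β
  le_inf := by rintro ⟨α⟩ ⟨β⟩ ⟨γ⟩ h₁ h₂; exact Gder.andR h₁ h₂
  le_sup_left := by rintro ⟨α⟩ ⟨β⟩; exact Gder.or_left α β
  le_sup_right := by rintro ⟨α⟩ ⟨β⟩; exact Gder.or_right α β
  sup_le := by rintro ⟨α⟩ ⟨β⟩ ⟨γ⟩ h₁ h₂; exact Gder.or_elim h₁ h₂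
  le_sup_inf := by rintro ⟨α⟩ ⟨β⟩ ⟨γ⟩; exact Gder.or_and_or α β γ

instance : BoundedOrder Lindenbaum where
  bot := mk FormulaB.bot
  bot_le := by rintro ⟨α⟩; exact Gder.botRule α (Gder.ax true _)
  top := mk FormulaB.bot.neg
  le_top := by rintro ⟨α⟩; exact Gder.neg_bot.weak α

theorem mk_eq_top {α : FormulaB} : mk α = ⊤ ↔ Gder true ∅ α := by
  rw [← top_le_iff]
  exact ⟨fun h => Gder.cut Gder.neg_bot h, fun h => h.weak _⟩

theorem mk_neg_congr {α β : FormulaB} (h : mk α = mk β) : mk α.neg = mk β.neg :=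
  mk_eq_mk.mpr ⟨Gder.negRule (mk_eq_mk.mp h).2, Gder.negRule (mk_eq_mk.mp h).1⟩

theorem mk_neg_neg (α : FormulaB) : mk α.neg.neg = mk α :=
  mk_eq_mk.mpr ⟨Gder.neg_neg_elim α, Gder.neg_neg_intro α⟩

theorem mk_neg_box_inf (α : FormulaB) : mk α.box.neg ⊓ mk α = mk α.neg ⊓ mk α :=
  mk_eq_mk.mpr ⟨Gder.neg_box_and α, Gder.neg_and_self α⟩

theorem mk_neg_box_sup (α : FormulaB) : mk α.box.neg ⊔ mk α = ⊤ := by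
  rw [sup_comm]
  exact mk_eq_top.mpr (Gder.modal true α)

/-- `¬□α` is the element `x` with `x ⊓ α = ¬α ⊓ α` and `x ⊔ α = ⊤`, which distributivity
makes unique. -/
theorem mk_box_congr {α β : FormulaB} (h : mk α = mk β) : mk α.box = mk β.box := by
  have key : mk α.box.neg = mk β.box.neg := by
    apply eq_of_inf_eq_sup_eq (a := mk β)
    · rw [mk_neg_box_inf β, ← h, mk_neg_box_inf α, mk_neg_congr h]
    · rw [mk_neg_box_sup β, ← h, mk_neg_box_sup α]
  rw [← mk_neg_neg α.box, mk_neg_congr key, mk_neg_neg]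

instance : TMA Lindenbaum where
  compl := Quotient.lift (fun α => mk α.neg) fun _ _ h => mk_neg_congr (Quotient.sound h)
  box := Quotient.lift (fun α => mk α.box) fun _ _ h => mk_box_congr (Quotient.sound h)
  compl_compl := by rintro ⟨α⟩; exact mk_neg_neg α
  compl_sup := by rintro ⟨α⟩ ⟨β⟩; exact mk_eq_mk.mpr ⟨Gder.neg_or α β, Gder.and_neg α β⟩
  compl_bot := rfl
  box_inf_compl := by rintro ⟨α⟩; exact le_bot_iff.mp (Gder.box_and_neg α)
  compl_box_inf := by rintro ⟨α⟩; exact mk_neg_box_inf α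

/-- The canonical homomorphism onto the Lindenbaum–Tarski algebra. -/
def canonicalHom : TMAHomB Lindenbaum where
  toFun := mk
  map_bot := rfl
  map_and _ _ := rfl
  map_or _ _ := rfl
  map_neg _ := rfl
  map_box _ := rfl

end Lindenbaum

theorem fontRius_theoremhood_and_order (ψ φ : FormulaB) :
    (Gder true ∅ ψ ↔ ∀ (A : Type) [TMA A], ∀ h : TMAHomB A, h.toFun ψ = ⊤) ∧
    (Gder true {ψ} φ ↔ ∀ (A : Type) [TMA A], ∀ h : TMAHomB A, h.toFun ψ ≤ h.toFun φ) := by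
  refine ⟨⟨fun d A _ h => ?_, fun H => ?_⟩, ⟨fun d A _ h => ?_, fun H => ?_⟩⟩
  · simpa using d.sound A h
  · exact Lindenbaum.mk_eq_top.mp (H Lindenbaum Lindenbaum.canonicalHom)
  · simpa using d.sound A h
  · exact Lindenbaum.mk_le_mk.mp (H Lindenbaum Lindenbaum.canonicalHom)
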